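/- arXiv:1903.00311 — 2 statements merged into one kernel-verified Lean document; each statement's English description precedes it below -/
import Mathlib

section
/- There exists an irrational ω ∈ (0,1) such that Σ_{n=1}^∞ (log q_{n+1})/q_n = ∞ (ω is not a Brjuno number), while for every Δ > 0 both Σ_{n=1}^∞ e^{−q_n Δ} q_{n+1} < ∞ and Σ_{n=1}^∞ e^{−2 q_n Δ} q_{n+1} log a_{n+1} < ∞ (ω is a semi-Brjuno number). -/
open Real
open scoped ENNReal

noncomputable section

/-- The Gauss-map iterates of `ω`. -/
def cfX (ω : ℝ) : ℕ → ℝ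
  | 0 => ω
  | n + 1 => Int.fract (cfX ω n)⁻¹

/-- The partial quotients of `ω`: for `n ≥ 1`, `cfA ω n = ⌊1 / x_{n-1}⌋`. -/
def cfA (ω : ℝ) : ℕ → ℕ
  | 0 => 0
  | n + 1 => (⌊(cfX ω n)⁻¹⌋).toNat

/-- Denominators of the convergents of `ω`. -/
def cfQ (ω : ℝ) : ℕ → ℕ
  | 0 => 1
  | 1 => cfA ω 1
  | n + 2 => cfA ω (n + 2) * cfQ ω (n + 1) + cfQ ω n

end

/-- Every sequence of integers `≥ 2` has a sequence of complete quotients, obtained by compactness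
of `[0,1]^ℕ`. -/
theorem exists_complete_quotients (b : ℕ → ℕ) (hb : ∀ n, 2 ≤ b n) :
    ∃ x : ℕ → ℝ, ∀ n, 0 < x n ∧ x n < 1 ∧ (x n)⁻¹ = b n + x (n + 1) := by
  have hb' : ∀ n, (2 : ℝ) ≤ b n := fun n => by exact_mod_cast hb n
  let I : Set (ℕ → ℝ) := Set.pi Set.univ fun _ => Set.Icc (0 : ℝ) 1
  let K : ℕ → Set (ℕ → ℝ) := fun N => I ∩ {x | ∀ n < N, x n * (b n + x (n + 1)) = 1}
  have hI : IsCompact I := isCompact_univ_pi fun _ => isCompact_Icc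
  have hclosed : ∀ N, IsClosed (K N) := fun N => by
    refine hI.isClosed.inter ?_
    simp only [Set.ofPred_forall]
    exact isClosed_iInter fun n => isClosed_iInter fun _ =>
      isClosed_eq (by fun_prop) continuous_const
  have hnonempty : ∀ N, ∀ c : ℕ → ℕ, (∀ n, 2 ≤ c n) →
      ∃ x ∈ I, ∀ n < N, x n * (c n + x (n + 1)) = 1 := by
    intro N
    induction N with
    | zero => exact fun _ _ => ⟨0, fun _ _ => by simp, by simp⟩
    | succ N ih =>
      intro c hc
      obtain ⟨x, hxI, hx⟩ := ih (fun n => c (n + 1)) fun n => hc (n + 1)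
      have h0 : 0 ≤ x 0 := (hxI 0 trivial).1
      have hc0 : (2 : ℝ) ≤ c 0 := by exact_mod_cast hc 0
      refine ⟨fun n => Nat.casesOn n (c 0 + x 0)⁻¹ x, fun n _ => ?_, fun n hn => ?_⟩
      · cases n with
        | zero => exact ⟨inv_nonneg.2 (by linarith), inv_le_one_of_one_le₀ (by linarith)⟩
        | succ n => exact hxI n trivial
      · cases n with
        | zero => exact inv_mul_cancel₀ (by linarith)
        | succ n => exact hx n (by omega)
  obtain ⟨x, hx⟩ := IsCompact.nonempty_iInter_of_sequence_nonempty_isCompact_isClosed K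
    (fun N x hx => ⟨hx.1, fun n hn => hx.2 n (by omega)⟩)
    (fun N => (hnonempty N b hb).imp fun x hx => hx)
    (hI.inter_right (by simp)) hclosed
  rw [Set.mem_iInter] at hx
  have hxI : ∀ n, 0 ≤ x n ∧ x n ≤ 1 := fun n => (hx 0).1 n trivial
  refine ⟨x, fun n => ?_⟩
  have h := (hx (n + 1)).2 n (by omega)
  have hinv : (x n)⁻¹ = b n + x (n + 1) := inv_eq_of_mul_eq_one_right h
  have hpos : 0 < x n := (hxI n).1.lt_of_ne fun h0 => by simp [← h0] at h
  refine ⟨hpos, ?_, hinv⟩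
  nlinarith [hb' n, hxI (n + 1)]

theorem irrational_of_complete_quotients (b : ℕ → ℕ) (x : ℕ → ℝ)
    (hx : ∀ n, 0 < x n ∧ x n < 1 ∧ (x n)⁻¹ = b n + x (n + 1)) (n : ℕ) : Irrational (x n) := by
  have key : ∀ d : ℕ, ∀ n, ∀ p : ℤ, x n * d = p → d = 0 := by
    intro d
    induction d using Nat.strong_induction_on with
    | _ d ih =>
      intro n p h
      by_contra hd
      have hd0 : (0 : ℝ) < d := by exact_mod_cast Nat.pos_of_ne_zero hd
      obtain ⟨h0, h1, hinv⟩ := hx n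
      have hp0 : (0 : ℝ) < p := h ▸ mul_pos h0 hd0
      have hpd : (p : ℝ) < d := by nlinarith
      lift p to ℕ using by exact_mod_cast hp0.le
      norm_cast at hp0 hpd
      refine hp0.ne' (ih p hpd (n + 1) (d - b n * p) ?_)
      have : x (n + 1) = (x n)⁻¹ - b n := by linarith
      have h' : (p : ℝ) = x n * d := by exact_mod_cast h.symm
      push_cast
      rw [this, h']
      field_simp
  rintro ⟨r, hr⟩
  refine r.den_nz (key r.den n r.num ?_)
  rw [← hr]
  exact_mod_cast Rat.mul_den_eq_num r

/-- Every sequence of integers `≥ 2` is the sequence of partial quotients of some irrational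
number in `(0,1)`. -/
theorem exists_irrational_cfA_eq (b : ℕ → ℕ) (hb : ∀ n, 2 ≤ b n) :
    ∃ ω : ℝ, Irrational ω ∧ 0 < ω ∧ ω < 1 ∧ ∀ n, cfA ω (n + 1) = b n := by
  obtain ⟨x, hx⟩ := exists_complete_quotients b hb
  have hX : ∀ n, cfX (x 0) n = x n := by
    intro n
    induction n with
    | zero => rfl
    | succ n ih =>
      rw [cfX, ih, (hx n).2.2, Int.fract_natCast_add, Int.fract_eq_self]
      exact ⟨(hx (n + 1)).1.le, (hx (n + 1)).2.1⟩
  refine ⟨x 0, irrational_of_complete_quotients b x hx 0, (hx 0).1, (hx 0).2.1, fun n => ?_⟩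
  have hfloor : ⌊x (n + 1)⌋ = 0 := Int.floor_eq_zero_iff.2 ⟨(hx (n + 1)).1.le, (hx (n + 1)).2.1⟩
  rw [cfA, hX, (hx n).2.2, Int.floor_natCast_add, hfloor]
  simp

/-- Denominators with `q (n + 2) = ⌈exp (q (n + 1) / (n + 1))⌉ * q (n + 1) + q n`, growing just fast
enough for the Brjuno sum to diverge like the harmonic series. -/
noncomputable def harmonicDenom : ℕ → ℕ
  | 0 => 1
  | 1 => 2
  | n + 2 => ⌈Real.exp (harmonicDenom (n + 1) / (n + 1))⌉₊ * harmonicDenom (n + 1) +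
      harmonicDenom n

/-- The partial quotients belonging to `harmonicDenom`, indexed from `0`. -/
noncomputable def harmonicQuot : ℕ → ℕ
  | 0 => 2
  | n + 1 => ⌈Real.exp (harmonicDenom (n + 1) / (n + 1))⌉₊

theorem harmonicDenom_pos : ∀ n, 0 < harmonicDenom n
  | 0 => by simp [harmonicDenom]
  | 1 => by simp [harmonicDenom]
  | n + 2 => by
    rw [harmonicDenom]
    exact Nat.add_pos_right _ (harmonicDenom_pos n)

theorem two_le_harmonicQuot : ∀ n, 2 ≤ harmonicQuot n
  | 0 => le_rfl
  | n + 1 => by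
    have h : (0 : ℝ) < harmonicDenom (n + 1) := by exact_mod_cast harmonicDenom_pos _
    rw [harmonicQuot, Nat.succ_le_iff, Nat.lt_ceil, Nat.cast_one, Real.one_lt_exp_iff]
    positivity

theorem harmonicDenom_add_two (n : ℕ) : harmonicDenom (n + 2) =
    harmonicQuot (n + 1) * harmonicDenom (n + 1) + harmonicDenom n := by
  rw [harmonicDenom, harmonicQuot]

theorem harmonicDenom_strictMono : StrictMono harmonicDenom :=
  strictMono_nat_of_lt_succ fun n => by
    cases n with
    | zero => simp [harmonicDenom]
    | succ n =>
      rw [harmonicDenom_add_two]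
      nlinarith [two_le_harmonicQuot (n + 1), harmonicDenom_pos (n + 1), harmonicDenom_pos n]

theorem exp_le_harmonicQuot (n : ℕ) :
    Real.exp (harmonicDenom (n + 1) / (n + 1)) ≤ harmonicQuot (n + 1) :=
  Nat.le_ceil _

theorem harmonicQuot_le (n : ℕ) :
    (harmonicQuot (n + 1) : ℝ) ≤ 2 * Real.exp (harmonicDenom (n + 1) / (n + 1)) := by
  have h1 : 1 ≤ Real.exp (harmonicDenom (n + 1) / (n + 1)) := Real.one_le_exp (by positivity)
  have h2 := Nat.ceil_lt_add_one (Real.exp_nonneg (harmonicDenom (n + 1) / (n + 1)))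
  rw [harmonicQuot]
  linarith

theorem harmonicDenom_add_two_le (n : ℕ) : (harmonicDenom (n + 2) : ℝ) ≤
    3 * harmonicDenom (n + 1) * Real.exp (harmonicDenom (n + 1) / (n + 1)) := by
  have h1 : 1 ≤ Real.exp (harmonicDenom (n + 1) / (n + 1)) := Real.one_le_exp (by positivity)
  have h2 : (harmonicDenom n : ℝ) ≤ harmonicDenom (n + 1) := by
    exact_mod_cast (harmonicDenom_strictMono n.lt_succ_self).le
  have h3 : (0 : ℝ) ≤ harmonicDenom (n + 1) := by positivity
  rw [harmonicDenom_add_two]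
  push_cast
  nlinarith [mul_le_mul_of_nonneg_right (harmonicQuot_le n) h3]

theorem inv_le_log_harmonicDenom_div (n : ℕ) :
    1 / ((n : ℝ) + 1) ≤ Real.log (harmonicDenom (n + 2)) / harmonicDenom (n + 1) := by
  have hq : (0 : ℝ) < harmonicDenom (n + 1) := by exact_mod_cast harmonicDenom_pos _
  have hq1 : (1 : ℝ) ≤ harmonicDenom (n + 1) := by exact_mod_cast harmonicDenom_pos (n + 1)
  have hle : Real.exp (harmonicDenom (n + 1) / (n + 1)) ≤ harmonicDenom (n + 2) := by
    rw [harmonicDenom_add_two]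
    push_cast
    nlinarith [exp_le_harmonicQuot n, Real.exp_pos (harmonicDenom (n + 1) / (n + 1)),
      (harmonicDenom n).cast_nonneg (α := ℝ)]
  rw [le_div_iff₀ hq, one_div_mul_eq_div]
  exact (Real.le_log_iff_exp_le (by exact_mod_cast harmonicDenom_pos _)).2 hle

theorem mul_exp_neg_le {q t c : ℝ} (ht : 0 < t) (hc : 0 < c) (hq : t ≤ q) :
    q * Real.exp (-(q * c)) ≤ 6 / c ^ 3 * (1 / t ^ 2) := by
  have hq0 : 0 < q := ht.trans_le hq
  have h := Real.pow_div_factorial_le_exp (q * c) (by positivity) 3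
  norm_num [Nat.factorial] at h
  calc q * Real.exp (-(q * c)) ≤ q * ((q * c) ^ 3 / 6)⁻¹ := by
        rw [Real.exp_neg]; gcongr
    _ = 6 / c ^ 3 * (1 / q ^ 2) := by field_simp
    _ ≤ 6 / c ^ 3 * (1 / t ^ 2) := by gcongr

theorem tsum_ofReal_ne_top_of_le_mul_exp {f : ℕ → ℝ} (hf : ∀ n, 0 ≤ f n) {c : ℝ} (hc : 0 < c)
    (h : ∀ᶠ n in Filter.atTop,
      f n ≤ 6 * (harmonicDenom (n + 1) * Real.exp (-(harmonicDenom (n + 1) * c)))) :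
    (∑' n, ENNReal.ofReal (f n)) ≠ ⊤ := by
  have hs : Summable fun n : ℕ => 6 * (6 / c ^ 3 * (1 / ((n : ℝ) + 1) ^ 2)) := by
    have := (summable_nat_add_iff 1).2 (Real.summable_one_div_nat_pow.2 one_lt_two)
    push_cast at this
    exact (this.mul_left _).mul_left _
  refine (Summable.of_norm_bounded_eventually_nat hs ?_).tsum_ofReal_ne_top
  filter_upwards [h] with n hn
  rw [Real.norm_of_nonneg (hf n)]
  refine hn.trans (mul_le_mul_of_nonneg_left (mul_exp_neg_le (by positivity) hc ?_) (by norm_num))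
  exact_mod_cast harmonicDenom_strictMono.id_le (n + 1)

theorem eventually_harmonicDenom_div_le {c : ℝ} (hc : 0 < c) : ∀ᶠ n : ℕ in Filter.atTop,
    (harmonicDenom (n + 1) : ℝ) / (n + 1) ≤ harmonicDenom (n + 1) * c := by
  filter_upwards [tendsto_one_div_add_atTop_nhds_zero_nat.eventually_le_const hc] with n hn
  rw [div_eq_mul_one_div]
  gcongr

/-- there exists an irrational `ω ∈ (0,1)` which is not Brjuno
(`Σ_{n=1}^∞ (log q_{n+1})/q_n = ∞`) but is semi-Brjuno (for every `Δ > 0` both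
`Σ_{n=1}^∞ e^{-q_n Δ} q_{n+1} < ∞` and `Σ_{n=1}^∞ e^{-2q_n Δ} q_{n+1} log a_{n+1} < ∞`). -/
theorem exists_semiBrjuno_not_brjuno :
    ∃ ω : ℝ, Irrational ω ∧ 0 < ω ∧ ω < 1 ∧
      (∑' n : ℕ, ENNReal.ofReal (Real.log (cfQ ω (n + 2) : ℝ) / (cfQ ω (n + 1) : ℝ))) = ⊤ ∧
      ∀ Δ : ℝ, 0 < Δ →
        (∑' n : ℕ, ENNReal.ofReal
            (Real.exp (-(cfQ ω (n + 1) : ℝ) * Δ) * (cfQ ω (n + 2) : ℝ))) ≠ ⊤ ∧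
        (∑' n : ℕ, ENNReal.ofReal
            (Real.exp (-2 * (cfQ ω (n + 1) : ℝ) * Δ) * (cfQ ω (n + 2) : ℝ) *
              Real.log (cfA ω (n + 2) : ℝ))) ≠ ⊤ := by
  obtain ⟨ω, hirr, h0, h1, hA⟩ := exists_irrational_cfA_eq harmonicQuot two_le_harmonicQuot
  have hQ : ∀ n, cfQ ω n = harmonicDenom n := by
    intro n
    induction n using Nat.twoStepInduction with
    | zero => rfl
    | one => rw [cfQ, hA, harmonicQuot, harmonicDenom]
    | more n ih ih' => rw [cfQ, hA, ih, ih', harmonicDenom_add_two]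
  refine ⟨ω, hirr, h0, h1, ?_, fun Δ hΔ => ⟨?_, ?_⟩⟩
  · simp only [hQ]
    by_contra htop
    have hle : (∑' n : ℕ, ENNReal.ofReal (1 / ((n : ℝ) + 1))) ≠ ⊤ :=
      ne_top_of_le_ne_top htop (ENNReal.tsum_le_tsum fun n =>
        ENNReal.ofReal_le_ofReal (inv_le_log_harmonicDenom_div n))
    refine Real.not_summable_one_div_natCast ((summable_nat_add_iff 1).1 ?_)
    refine (ENNReal.summable_toReal hle).congr fun n => ?_
    rw [ENNReal.toReal_ofReal (by positivity)]
    push_cast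
    rfl
  · simp only [hQ]
    refine tsum_ofReal_ne_top_of_le_mul_exp (fun n => by positivity) (half_pos hΔ) ?_
    filter_upwards [eventually_harmonicDenom_div_le (half_pos hΔ)] with n hn
    set q : ℝ := (harmonicDenom (n + 1) : ℝ) with hq
    calc Real.exp (-q * Δ) * harmonicDenom (n + 2)
        ≤ Real.exp (-q * Δ) * (3 * q * Real.exp (q * (Δ / 2))) := by
          gcongr
          exact (harmonicDenom_add_two_le n).trans (by gcongr)
      _ = 3 * (q * Real.exp (-(q * (Δ / 2)))) := by
          rw [show -(q * (Δ / 2)) = -q * Δ + q * (Δ / 2) by ring, Real.exp_add]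
          ring
      _ ≤ 6 * (q * Real.exp (-(q * (Δ / 2)))) := by
          gcongr
          norm_num
  · simp only [hQ, hA]
    refine tsum_ofReal_ne_top_of_le_mul_exp (fun n => ?_) hΔ ?_
    · have := Real.log_natCast_nonneg (harmonicQuot (n + 1))
      positivity
    filter_upwards [eventually_harmonicDenom_div_le (half_pos hΔ)] with n hn
    set q : ℝ := (harmonicDenom (n + 1) : ℝ) with hq
    have hlog : Real.log (harmonicQuot (n + 1)) ≤ 2 * Real.exp (q * (Δ / 2)) :=
      (Real.log_le_self (Nat.cast_nonneg _)).trans ((harmonicQuot_le n).trans (by gcongr))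
    have hnonneg := Real.log_natCast_nonneg (harmonicQuot (n + 1))
    calc Real.exp (-2 * q * Δ) * harmonicDenom (n + 2) * Real.log (harmonicQuot (n + 1))
        ≤ Real.exp (-2 * q * Δ) * (3 * q * Real.exp (q * (Δ / 2))) *
            (2 * Real.exp (q * (Δ / 2))) := by
          gcongr
          exact (harmonicDenom_add_two_le n).trans (by gcongr)
      _ = 6 * (q * Real.exp (-(q * Δ))) := by
          rw [show -(q * Δ) = -2 * q * Δ + q * (Δ / 2) + q * (Δ / 2) by ring, Real.exp_add,
            Real.exp_add]
          ring
end

section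
/- Let ρ > 0, ε > 0, let ω ∈ (0,1) be irrational, let 0 < δ' < δ < ρ, and set Δ = (1+ω)δ. Suppose Σ_{n=1}^∞ e^{−q_n Δ} q_{n+1} = ∞ or Σ_{n=1}^∞ e^{−2 q_n Δ} q_{n+1} log a_{n+1} = ∞. Then there is no function g ∈ 𝒫₀(ρ−δ') whose Fourier coefficients g_{p,q} satisfy i(p − qω) g_{p,q} = â_{p,q} for all (p,q) ∈ ℤ²∖{(0,0)}; in particular no g ∈ 𝒫₀(ρ−δ') satisfies (∂_x + ω∂_y) g = â on Π(ρ−δ')², where â ∈ 𝒫₀(ρ) is the function with Fourier coefficients â_{p,q}. -/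
open Real Complex
open scoped ENNReal

noncomputable section

/-- The open horizontal strip `Π(ρ) = {z ∈ ℂ : |Im z| < ρ}`. -/
def openStrip (ρ : ℝ) : Set ℂ := {z : ℂ | |z.im| < ρ}

/-- The closed horizontal strip `cl(Π(ρ)) = {z ∈ ℂ : |Im z| ≤ ρ}`. -/
def closedStrip (ρ : ℝ) : Set ℂ := {z : ℂ | |z.im| ≤ ρ}

/-- The Fourier basis function `e_{p,q}(x,y) = exp(i(px - qy))`. -/
def efun (p q : ℤ) (z : ℂ × ℂ) : ℂ :=
  Complex.exp (Complex.I * ((p : ℂ) * z.1 - (q : ℂ) * z.2))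

/-- Membership in the class `𝒫₀(ρ)`: continuous on the closed bi-strip, holomorphic on the
open bi-strip, `2π`-periodic in each variable, real-valued on `ℝ²`, with zero average. -/
structure MemP0 (ρ : ℝ) (b : ℂ × ℂ → ℂ) : Prop where
  contOn : ContinuousOn b (closedStrip ρ ×ˢ closedStrip ρ)
  diffOn : DifferentiableOn ℂ b (openStrip ρ ×ˢ openStrip ρ)
  periodic_fst : ∀ z : ℂ × ℂ, b (z.1 + 2 * Real.pi, z.2) = b z
  periodic_snd : ∀ z : ℂ × ℂ, b (z.1, z.2 + 2 * Real.pi) = b z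
  real_on_real : ∀ x y : ℝ, (b ((x : ℂ), (y : ℂ))).im = 0
  zero_avg : (∫ x in (0 : ℝ)..(2 * Real.pi), ∫ y in (0 : ℝ)..(2 * Real.pi),
    b ((x : ℂ), (y : ℂ))) = 0

/-- The sup norm `‖b‖_ρ` over the closed bi-strip. -/
def supNorm (ρ : ℝ) (b : ℂ × ℂ → ℂ) : ℝ :=
  ⨆ z : (closedStrip ρ ×ˢ closedStrip ρ : Set (ℂ × ℂ)), ‖b z‖

/-- The `(p,q)`-th Fourier coefficient
`b_{p,q} = (2π)⁻² ∫∫ b(x,y) e^{-i(px-qy)} dx dy`. -/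
def fcoeff (b : ℂ × ℂ → ℂ) (p q : ℤ) : ℂ :=
  (1 / (2 * Real.pi) ^ 2 : ℝ) *
    ∫ x in (0 : ℝ)..(2 * Real.pi), ∫ y in (0 : ℝ)..(2 * Real.pi),
      b ((x : ℂ), (y : ℂ)) * Complex.exp (-Complex.I * ((p : ℂ) * x - (q : ℂ) * y))

/-- The cohomological operator `(∂_x + ω ∂_y) g` at `z`. -/
def cohomOp (ω : ℝ) (g : ℂ × ℂ → ℂ) (z : ℂ × ℂ) : ℂ :=
  fderiv ℂ g z (1, 0) + (ω : ℂ) * fderiv ℂ g z (0, 1)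

end

noncomputable section

/-- Numerators of the convergents of `ω`. -/
def cfP (ω : ℝ) : ℕ → ℕ
  | 0 => 0
  | 1 => 1
  | n + 2 => cfA ω (n + 2) * cfP ω (n + 1) + cfP ω n

/-- `ᾱ = Σ_{n=1}^∞ 1/q_n`. -/
def alphaBar (ω : ℝ) : ℝ := ∑' n : ℕ, ((cfQ ω (n + 1) : ℝ))⁻¹

/-- `α_n = 1/(2 ᾱ q_n)`. -/
def alphaN (ω : ℝ) (n : ℕ) : ℝ := (2 * alphaBar ω * (cfQ ω n : ℝ))⁻¹

end

noncomputable section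

open scoped Classical

/-- Fourier coefficients of the counterexample initial datum `â`:
`â_{p,q} = ε e^{-ρ(|p|+|q|)} α_n` if `(p,q) = ±(p_n,q_n)` for some `n ≥ 1`, else `0`. -/
def ahatCoeff (ω ρ ε : ℝ) (p q : ℤ) : ℝ :=
  ∑' n : ℕ,
    if (p, q) = ((cfP ω (n + 1) : ℤ), (cfQ ω (n + 1) : ℤ)) ∨
        (p, q) = (-(cfP ω (n + 1) : ℤ), -(cfQ ω (n + 1) : ℤ)) then
      ε * Real.exp (-ρ * ((|p| + |q| : ℤ) : ℝ)) * alphaN ω (n + 1)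
    else 0

/-- The counterexample initial datum `â`, the sum of the series
`Σ_{n=1}^∞ ε α_n e^{-ρ(p_n+q_n)} (e_{p_n,q_n} + e_{-p_n,-q_n})`. -/
def ahatFun (ω ρ ε : ℝ) (z : ℂ × ℂ) : ℂ :=
  ∑' n : ℕ,
    ((ε * alphaN ω (n + 1) *
        Real.exp (-ρ * ((cfP ω (n + 1) : ℝ) + (cfQ ω (n + 1) : ℝ))) : ℝ) : ℂ) *
      (efun (cfP ω (n + 1) : ℤ) (cfQ ω (n + 1) : ℤ) z +
        efun (-(cfP ω (n + 1) : ℤ)) (-(cfQ ω (n + 1) : ℤ)) z)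

end

theorem cfX_irrational {ω : ℝ} (h : Irrational ω) (n : ℕ) : Irrational (cfX ω n) := by
  induction n with
  | zero => exact h
  | succ n ih =>
    have h1 : Irrational (cfX ω n)⁻¹ := irrational_inv_iff.2 ih
    rw [cfX, Int.fract]
    exact h1.sub_intCast _

theorem cfX_mem_Ioo {ω : ℝ} (h : Irrational ω) (h0 : 0 < ω) (h1 : ω < 1) (n : ℕ) :
    cfX ω n ∈ Set.Ioo (0 : ℝ) 1 := by
  cases n with
  | zero => exact ⟨h0, h1⟩
  | succ n =>
    refine ⟨lt_of_le_of_ne (Int.fract_nonneg _) ?_, Int.fract_lt_one _⟩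
    exact ((cfX_irrational h (n + 1)).ne_zero).symm

theorem cfX_inv {ω : ℝ} (h : Irrational ω) (h0 : 0 < ω) (h1 : ω < 1) (n : ℕ) :
    (cfX ω n)⁻¹ = cfA ω (n + 1) + cfX ω (n + 1) := by
  have hx := (cfX_mem_Ioo h h0 h1 n).1
  have hnn : 0 ≤ ⌊(cfX ω n)⁻¹⌋ := Int.floor_nonneg.2 (inv_pos.2 hx).le
  have hc : ((cfA ω (n + 1) : ℕ) : ℝ) = ((⌊(cfX ω n)⁻¹⌋ : ℤ) : ℝ) := by
    rw [cfA, ← Int.cast_natCast, Int.toNat_of_nonneg hnn]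
  rw [hc, cfX]
  exact (Int.floor_add_fract _).symm

theorem one_le_cfA {ω : ℝ} (h : Irrational ω) (h0 : 0 < ω) (h1 : ω < 1) (n : ℕ) :
    1 ≤ cfA ω (n + 1) := by
  have hx := cfX_mem_Ioo h h0 h1 n
  have : (1 : ℤ) ≤ ⌊(cfX ω n)⁻¹⌋ := by
    rw [Int.le_floor]
    simpa using (one_lt_inv₀ hx.1).2 hx.2 |>.le
  rw [cfA]
  omega

theorem cfQ_pos {ω : ℝ} (h : Irrational ω) (h0 : 0 < ω) (h1 : ω < 1) (n : ℕ) :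
    0 < cfQ ω n := by
  induction n using Nat.strong_induction_on with
  | _ n ih =>
    match n with
    | 0 => exact Nat.one_pos
    | 1 => exact one_le_cfA h h0 h1 0
    | n + 2 =>
      rw [cfQ]
      exact Nat.add_pos_right _ (ih n (by omega))

theorem cfQ_add_le {ω : ℝ} (h : Irrational ω) (h0 : 0 < ω) (h1 : ω < 1) (n : ℕ) :
    cfQ ω (n + 1) + cfQ ω n ≤ cfQ ω (n + 2) := by
  rw [cfQ]
  gcongr
  exact Nat.le_mul_of_pos_left _ (one_le_cfA h h0 h1 (n + 1))

theorem cfA_le_cfQ {ω : ℝ} (h : Irrational ω) (h0 : 0 < ω) (h1 : ω < 1) (n : ℕ) :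
    cfA ω (n + 2) ≤ cfQ ω (n + 2) := by
  rw [cfQ]
  exact (Nat.le_mul_of_pos_right _ (cfQ_pos h h0 h1 _)).trans (Nat.le_add_right _ _)

theorem cfQ_succ_strictMono {ω : ℝ} (h : Irrational ω) (h0 : 0 < ω) (h1 : ω < 1) :
    StrictMono fun n => cfQ ω (n + 1) := by
  refine strictMono_nat_of_lt_succ fun n => ?_
  have := cfQ_add_le h h0 h1 n
  have := cfQ_pos h h0 h1 n
  show cfQ ω (n + 1) < cfQ ω (n + 2)
  omega

theorem geometric_le_cfQ {ω : ℝ} (h : Irrational ω) (h0 : 0 < ω) (h1 : ω < 1) (n : ℕ) :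
    (2 / 3 : ℝ) * (3 / 2) ^ n ≤ cfQ ω n := by
  induction n using Nat.strong_induction_on with
  | _ n ih =>
    match n with
    | 0 => norm_num [cfQ]
    | 1 =>
      have : (1 : ℝ) ≤ cfQ ω 1 := by exact_mod_cast cfQ_pos h h0 h1 1
      norm_num
      exact_mod_cast this
    | n + 2 =>
      have hle : (cfQ ω (n + 1) : ℝ) + cfQ ω n ≤ cfQ ω (n + 2) := by
        exact_mod_cast cfQ_add_le h h0 h1 n
      have i0 := ih n (by omega)
      have i1 := ih (n + 1) (by omega)
      have hp : (0 : ℝ) < (3 / 2) ^ n := by positivity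
      rw [pow_succ] at i1
      rw [pow_succ, pow_succ]
      linarith

theorem summable_inv_cfQ {ω : ℝ} (h : Irrational ω) (h0 : 0 < ω) (h1 : ω < 1) :
    Summable fun n : ℕ => ((cfQ ω (n + 1) : ℝ))⁻¹ := by
  have hg : Summable fun n : ℕ => (3 / 2 : ℝ) * (2 / 3) ^ (n + 1) :=
    ((summable_nat_add_iff 1).2
      (summable_geometric_of_lt_one (by norm_num) (by norm_num))).mul_left _
  refine Summable.of_nonneg_of_le (fun n => by positivity) (fun n => ?_) hg
  refine (inv_anti₀ (by positivity) (geometric_le_cfQ h h0 h1 (n + 1))).trans (le_of_eq ?_)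
  rw [mul_inv, ← inv_pow]
  norm_num

theorem alphaBar_pos {ω : ℝ} (h : Irrational ω) (h0 : 0 < ω) (h1 : ω < 1) :
    0 < alphaBar ω := by
  refine (summable_inv_cfQ h h0 h1).tsum_pos (fun n => by positivity) 0 ?_
  exact inv_pos.2 (Nat.cast_pos.2 (cfQ_pos h h0 h1 _))

theorem alphaN_pos {ω : ℝ} (h : Irrational ω) (h0 : 0 < ω) (h1 : ω < 1) (n : ℕ) :
    0 < alphaN ω n := by
  have := alphaBar_pos h h0 h1
  have : (0 : ℝ) < cfQ ω n := Nat.cast_pos.2 (cfQ_pos h h0 h1 n)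
  rw [alphaN]
  positivity

theorem summable_alphaN {ω : ℝ} (h : Irrational ω) (h0 : 0 < ω) (h1 : ω < 1) :
    Summable fun n : ℕ => alphaN ω (n + 1) := by
  simp only [alphaN, mul_inv]
  exact (summable_inv_cfQ h h0 h1).mul_left _

theorem convergent_error_succ {ω : ℝ} (h : Irrational ω) (h0 : 0 < ω) (h1 : ω < 1) (n : ℕ) :
    (cfP ω (n + 1) : ℝ) - cfQ ω (n + 1) * ω =
      -cfX ω (n + 1) * ((cfP ω n : ℝ) - cfQ ω n * ω) := by
  induction n with
  | zero =>
    have hinv : ω⁻¹ = cfA ω 1 + cfX ω 1 := cfX_inv h h0 h1 0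
    field_simp at hinv
    simp only [cfP, cfQ, zero_add, Nat.cast_one, Nat.cast_zero]
    linarith
  | succ n ih =>
    have hinv := cfX_inv h h0 h1 (n + 1)
    have hx := (cfX_mem_Ioo h h0 h1 (n + 1)).1
    rw [inv_eq_one_div, div_eq_iff hx.ne'] at hinv
    rw [show n + 1 + 1 = n + 2 from rfl] at *
    have e1 : (cfP ω (n + 2) : ℝ) = cfA ω (n + 2) * cfP ω (n + 1) + cfP ω n := by
      rw [cfP]; push_cast; ring
    have e2 : (cfQ ω (n + 2) : ℝ) = cfA ω (n + 2) * cfQ ω (n + 1) + cfQ ω n := by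
      rw [cfQ]; push_cast; ring
    rw [e1, e2]
    linear_combination (cfA ω (n + 2) + cfX ω (n + 2)) * ih +
      ((cfP ω n : ℝ) - cfQ ω n * ω) * hinv

theorem convergent_error_wronskian {ω : ℝ} (h : Irrational ω) (h0 : 0 < ω) (h1 : ω < 1) (n : ℕ) :
    cfQ ω (n + 1) * |(cfP ω n : ℝ) - cfQ ω n * ω| +
      cfQ ω n * |(cfP ω (n + 1) : ℝ) - cfQ ω (n + 1) * ω| = 1 := by
  have habs (n : ℕ) : |(cfP ω (n + 1) : ℝ) - cfQ ω (n + 1) * ω| =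
      cfX ω (n + 1) * |(cfP ω n : ℝ) - cfQ ω n * ω| := by
    rw [convergent_error_succ h h0 h1, abs_mul, abs_neg,
      abs_of_pos (cfX_mem_Ioo h h0 h1 (n + 1)).1]
  induction n with
  | zero =>
    rw [habs]
    have hinv : ω⁻¹ = cfA ω 1 + cfX ω 1 := cfX_inv h h0 h1 0
    field_simp at hinv
    simp only [cfP, cfQ, zero_add, Nat.cast_one, Nat.cast_zero, one_mul, zero_sub, abs_neg,
      abs_of_pos h0]
    linarith
  | succ n ih =>
    have hinv := cfX_inv h h0 h1 (n + 1)
    have hx := (cfX_mem_Ioo h h0 h1 (n + 1)).1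
    rw [inv_eq_one_div, div_eq_iff hx.ne'] at hinv
    rw [show n + 1 + 1 = n + 2 from rfl] at *
    have e2 : (cfQ ω (n + 2) : ℝ) = cfA ω (n + 2) * cfQ ω (n + 1) + cfQ ω n := by
      rw [cfQ]; push_cast; ring
    rw [habs (n + 1), e2, habs n]
    rw [habs n] at ih
    linear_combination ih -
      cfQ ω (n + 1) * |(cfP ω n : ℝ) - cfQ ω n * ω| * hinv

theorem cfQ_succ_mul_abs_error_le_one {ω : ℝ} (h : Irrational ω) (h0 : 0 < ω) (h1 : ω < 1)
    (n : ℕ) : cfQ ω (n + 1) * |(cfP ω n : ℝ) - cfQ ω n * ω| ≤ 1 := by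
  have := convergent_error_wronskian h h0 h1 n
  have : 0 ≤ cfQ ω n * |(cfP ω (n + 1) : ℝ) - cfQ ω (n + 1) * ω| := by positivity
  linarith

theorem cfP_le {ω : ℝ} (h : Irrational ω) (h0 : 0 < ω) (h1 : ω < 1) (n : ℕ) :
    (cfP ω n : ℝ) ≤ cfQ ω n * ω + 1 := by
  have hle := cfQ_succ_mul_abs_error_le_one h h0 h1 n
  have hq : (1 : ℝ) ≤ cfQ ω (n + 1) := by exact_mod_cast cfQ_pos h h0 h1 (n + 1)
  have := le_abs_self ((cfP ω n : ℝ) - cfQ ω n * ω)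
  nlinarith [abs_nonneg ((cfP ω n : ℝ) - cfQ ω n * ω)]

theorem ahatCoeff_convergent {ω : ℝ} (h : Irrational ω) (h0 : 0 < ω) (h1 : ω < 1) (ρ ε : ℝ)
    (n : ℕ) :
    ahatCoeff ω ρ ε (cfP ω (n + 1) : ℤ) (cfQ ω (n + 1) : ℤ) =
      ε * alphaN ω (n + 1) *
        Real.exp (-ρ * ((cfP ω (n + 1) : ℝ) + (cfQ ω (n + 1) : ℝ))) := by
  rw [ahatCoeff, tsum_eq_single n]
  · rw [if_pos (Or.inl rfl), Nat.abs_cast, Nat.abs_cast]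
    push_cast
    ring
  · intro m hm
    rw [if_neg]
    have hp := cfQ_pos h h0 h1 (n + 1)
    rintro (he | he)
    · have h2 := congrArg Prod.snd he
      exact hm ((cfQ_succ_strictMono h h0 h1).injective (Int.ofNat_injective h2)).symm
    · have h2 := congrArg Prod.snd he
      simp only at h2
      omega

/-- The growth bound on denominators forced by a solution is incompatible with divergence. -/
theorem brjuno_sums_ne_top {ω C κ Δ : ℝ} (h : Irrational ω) (h0 : 0 < ω) (h1 : ω < 1)
    (hκ : κ < Δ)
    (hC : ∀ n : ℕ, (cfQ ω (n + 2) : ℝ) ≤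
      C * cfQ ω (n + 1) * Real.exp (κ * cfQ ω (n + 1))) :
    (∑' n : ℕ, ENNReal.ofReal
        (Real.exp (-(cfQ ω (n + 1) : ℝ) * Δ) * (cfQ ω (n + 2) : ℝ))) ≠ ⊤ ∧
    (∑' n : ℕ, ENNReal.ofReal
        (Real.exp (-2 * (cfQ ω (n + 1) : ℝ) * Δ) * (cfQ ω (n + 2) : ℝ) *
          Real.log (cfA ω (n + 2) : ℝ))) ≠ ⊤ := by
  have hinj := (cfQ_succ_strictMono h h0 h1).injective
  have hlog (n : ℕ) : 0 ≤ Real.log (cfA ω (n + 2) : ℝ) :=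
    Real.log_nonneg (by exact_mod_cast one_le_cfA h h0 h1 (n + 1))
  have hlog' (n : ℕ) : Real.log (cfA ω (n + 2) : ℝ) ≤ cfQ ω (n + 2) :=
    (Real.log_le_self (Nat.cast_nonneg _)).trans (by exact_mod_cast cfA_le_cfQ h h0 h1 n)
  constructor
  · refine Summable.tsum_ofReal_ne_top ?_
    have hs := ((Real.summable_pow_mul_exp_neg_nat_mul 1 (sub_pos.2 hκ)).comp_injective
      hinj).mul_left C
    refine Summable.of_nonneg_of_le (fun n => by positivity) (fun n => ?_) hs
    refine (mul_le_mul_of_nonneg_left (hC n) (Real.exp_nonneg _)).trans (le_of_eq ?_)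
    simp only [Function.comp_apply, pow_one]
    rw [show -(Δ - κ) * (cfQ ω (n + 1) : ℝ) =
      -(cfQ ω (n + 1) : ℝ) * Δ + κ * cfQ ω (n + 1) by ring, Real.exp_add]
    ring
  · refine Summable.tsum_ofReal_ne_top ?_
    have hs := ((Real.summable_pow_mul_exp_neg_nat_mul 2
      (mul_pos two_pos (sub_pos.2 hκ))).comp_injective hinj).mul_left (C ^ 2)
    refine Summable.of_nonneg_of_le
      (fun n => mul_nonneg (by positivity) (hlog n)) (fun n => ?_) hs
    calc Real.exp (-2 * (cfQ ω (n + 1) : ℝ) * Δ) * (cfQ ω (n + 2) : ℝ) *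
          Real.log (cfA ω (n + 2) : ℝ)
        ≤ Real.exp (-2 * (cfQ ω (n + 1) : ℝ) * Δ) * (cfQ ω (n + 2) : ℝ) * cfQ ω (n + 2) :=
          mul_le_mul_of_nonneg_left (hlog' n) (by positivity)
      _ = Real.exp (-2 * (cfQ ω (n + 1) : ℝ) * Δ) * (cfQ ω (n + 2) : ℝ) ^ 2 := by ring
      _ ≤ Real.exp (-2 * (cfQ ω (n + 1) : ℝ) * Δ) *
          (C * cfQ ω (n + 1) * Real.exp (κ * cfQ ω (n + 1))) ^ 2 := by
        gcongr
        exact hC n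
      _ = _ := by
        simp only [Function.comp_apply]
        rw [show -(2 * (Δ - κ)) * (cfQ ω (n + 1) : ℝ) =
          -2 * (cfQ ω (n + 1) : ℝ) * Δ + (κ * cfQ ω (n + 1) + κ * cfQ ω (n + 1)) by ring,
          Real.exp_add, Real.exp_add]
        ring

theorem integral_add_mul_I_eq {f : ℂ → ℂ} {r t : ℝ} (hf : DifferentiableOn ℂ f (openStrip r))
    (hper : ∀ z, f (z + 2 * Real.pi) = f z) (ht : |t| < r) :
    ∫ x in (0 : ℝ)..(2 * Real.pi), f (x + t * I) = ∫ x in (0 : ℝ)..(2 * Real.pi), f x := by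
  have hsub : (Set.uIcc (0 : ℂ).re (2 * Real.pi + t * I : ℂ).re ×ℂ
      Set.uIcc (0 : ℂ).im (2 * Real.pi + t * I : ℂ).im) ⊆ openStrip r := by
    intro z hz
    have him : z.im ∈ Set.uIcc (0 : ℝ) t := by simpa using hz.2
    have hle := Set.abs_sub_left_of_mem_uIcc him
    simp only [sub_zero] at hle
    exact hle.trans_lt ht
  have key := Complex.integral_boundary_rect_eq_zero_of_differentiableOn f 0
    (2 * Real.pi + t * I) (hf.mono hsub)
  have hedge (y : ℝ) : f (2 * Real.pi + y * I) = f (y * I) := by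
    rw [add_comm, hper]
  simp [hedge] at key
  exact (sub_eq_zero.1 key).symm

/-- The Fourier character conjugate to `efun p q`. -/
noncomputable def efunInv (p q : ℤ) (z : ℂ × ℂ) : ℂ :=
  Complex.exp (-Complex.I * ((p : ℂ) * z.1 - (q : ℂ) * z.2))

theorem differentiable_efunInv (p q : ℤ) : Differentiable ℂ (efunInv p q) := by
  unfold efunInv
  fun_prop

theorem continuous_efun (p q : ℤ) : Continuous (efun p q) := by
  unfold efun
  fun_prop

theorem efunInv_periodic_fst (p q : ℤ) (z : ℂ × ℂ) :
    efunInv p q (z.1 + 2 * Real.pi, z.2) = efunInv p q z := by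
  rw [efunInv, efunInv, Complex.exp_eq_exp_iff_exists_int]
  exact ⟨-p, by push_cast; ring⟩

theorem efunInv_periodic_snd (p q : ℤ) (z : ℂ × ℂ) :
    efunInv p q (z.1, z.2 + 2 * Real.pi) = efunInv p q z := by
  rw [efunInv, efunInv, Complex.exp_eq_exp_iff_exists_int]
  exact ⟨q, by push_cast; ring⟩

theorem norm_efunInv (p q : ℤ) (z : ℂ × ℂ) :
    ‖efunInv p q z‖ = Real.exp (p * z.1.im - q * z.2.im) := by
  rw [efunInv, Complex.norm_exp]
  simp

theorem norm_efun_ofReal (p q : ℤ) (x y : ℝ) : ‖efun p q (x, y)‖ = 1 := by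
  rw [efun, Complex.norm_exp]
  simp

theorem efun_mul_efunInv (p q p' q' : ℤ) (z : ℂ × ℂ) :
    efun p' q' z * efunInv p q z = efun (p' - p) (q' - q) z := by
  rw [efun, efunInv, efun, ← Complex.exp_add]
  congr 1
  push_cast
  ring

theorem MemP0.exists_bound {r : ℝ} {g : ℂ × ℂ → ℂ} (hg : MemP0 r g) :
    ∃ M : ℝ, 0 ≤ M ∧ ∀ z ∈ closedStrip r ×ˢ closedStrip r, ‖g z‖ ≤ M := by
  let K : Set ℂ := Set.Icc 0 (2 * Real.pi) ×ℂ Set.Icc (-r) r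
  have hK : IsCompact K := isCompact_Icc.reProdIm isCompact_Icc
  have hsub : K ×ˢ K ⊆ closedStrip r ×ˢ closedStrip r := by
    refine Set.prod_mono ?_ ?_ <;> exact fun z hz => abs_le.2 hz.2
  obtain ⟨M, hM⟩ := (hK.prod hK).exists_bound_of_continuousOn (hg.contOn.mono hsub)
  have hred (z : ℂ) (hz : z ∈ closedStrip r) : ∃ n : ℤ, z - n • (2 * Real.pi : ℂ) ∈ K := by
    have hmem := toIcoMod_mem_Ico Real.two_pi_pos 0 z.re
    refine ⟨toIcoDiv Real.two_pi_pos 0 z.re, ?_, ?_⟩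
    · rw [toIcoMod] at hmem
      simpa using Set.Ico_subset_Icc_self hmem
    · simpa using abs_le.1 hz
  refine ⟨max M 0, le_max_right _ _, fun z hz => ?_⟩
  obtain ⟨m, hm⟩ := hred z.1 hz.1
  obtain ⟨n, hn⟩ := hred z.2 hz.2
  have hp1 (w : ℂ) : Function.Periodic (fun x => g (x, w)) (2 * Real.pi : ℂ) :=
    fun x => hg.periodic_fst (x, w)
  have hp2 (w : ℂ) : Function.Periodic (fun y => g (w, y)) (2 * Real.pi : ℂ) :=
    fun y => hg.periodic_snd (w, y)
  have h1 := (hp1 (z.2 - n • (2 * Real.pi : ℂ))).sub_zsmul_eq (x := z.1) m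
  have h2 := (hp2 z.1).sub_zsmul_eq (x := z.2) n
  have h3 : g (z.1 - m • (2 * Real.pi : ℂ), z.2 - n • (2 * Real.pi : ℂ)) = g z := h1.trans h2
  rw [← h3]
  exact (hM _ ⟨hm, hn⟩).trans (le_max_left _ _)

theorem openStrip_subset_closedStrip (r : ℝ) : openStrip r ⊆ closedStrip r :=
  fun z hz => (show |z.im| < r from hz).le

theorem ofReal_mem_openStrip {r : ℝ} (hr : 0 < r) (x : ℝ) : (x : ℂ) ∈ openStrip r := by
  simpa [openStrip] using hr

theorem isOpen_openStrip (r : ℝ) : IsOpen (openStrip r) :=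
  isOpen_lt (by fun_prop) continuous_const

theorem fcoeff_eq_integral_efunInv (b : ℂ × ℂ → ℂ) (p q : ℤ) :
    fcoeff b p q = (1 / (2 * Real.pi) ^ 2 : ℝ) *
      ∫ x in (0 : ℝ)..(2 * Real.pi), ∫ y in (0 : ℝ)..(2 * Real.pi),
        b ((x : ℂ), (y : ℂ)) * efunInv p q (x, y) := rfl

/-- Exponential bound on the Fourier coefficients, meaningful for nonnegative indices. -/
theorem MemP0.exists_norm_fcoeff_le {r s : ℝ} {g : ℂ × ℂ → ℂ} (hg : MemP0 r g) (hs : 0 ≤ s)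
    (hsr : s < r) :
    ∃ M : ℝ, 0 ≤ M ∧ ∀ p q : ℤ, ‖fcoeff g p q‖ ≤ M * Real.exp (-s * (p + q)) := by
  obtain ⟨M, hM0, hM⟩ := hg.exists_bound
  refine ⟨M, hM0, fun p q => ?_⟩
  have hr : 0 < r := hs.trans_lt hsr
  have habs : |s| < r := by rwa [abs_of_nonneg hs]
  let G : ℂ × ℂ → ℂ := fun z => g z * efunInv p q z
  have hG : DifferentiableOn ℂ G (openStrip r ×ˢ openStrip r) :=
    hg.diffOn.mul (differentiable_efunInv p q).differentiableOn
  have hshift (x : ℝ) (t : ℝ) (ht : |t| < r) : (x + t * I : ℂ) ∈ openStrip r := by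
    simpa [openStrip] using ht
  have hy (x : ℝ) : ∫ y in (0 : ℝ)..(2 * Real.pi), G (x, y) =
      ∫ y in (0 : ℝ)..(2 * Real.pi), G (x, y + s * I) := by
    refine (integral_add_mul_I_eq (f := fun w => G (x, w)) ?_ ?_ habs).symm
    · exact hG.comp (by fun_prop) fun w hw => ⟨ofReal_mem_openStrip hr x, hw⟩
    · intro w
      simp only [G]
      rw [hg.periodic_snd (x, w), efunInv_periodic_snd p q (x, w)]
  have hx (y : ℝ) : ∫ x in (0 : ℝ)..(2 * Real.pi), G (x, y + s * I) =
      ∫ x in (0 : ℝ)..(2 * Real.pi), G (x + (-s : ℝ) * I, y + s * I) := by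
    refine (integral_add_mul_I_eq (f := fun w => G (w, y + s * I)) ?_ ?_ (by rwa [abs_neg])).symm
    · exact hG.comp (by fun_prop) fun w hw => ⟨hw, hshift y s habs⟩
    · intro w
      simp only [G]
      rw [hg.periodic_fst (w, y + s * I), efunInv_periodic_fst p q (w, y + s * I)]
  have hswap : ∫ x in (0 : ℝ)..(2 * Real.pi), ∫ y in (0 : ℝ)..(2 * Real.pi), G (x, y + s * I) =
      ∫ y in (0 : ℝ)..(2 * Real.pi), ∫ x in (0 : ℝ)..(2 * Real.pi), G (x, y + s * I) := by
    refine MeasureTheory.intervalIntegral_intervalIntegral_swap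
      (F := fun x y : ℝ => G (x, y + s * I)) ?_
    have hc : Continuous (Function.uncurry fun x y : ℝ => G (x, y + s * I)) :=
      hG.continuousOn.comp_continuous (by fun_prop)
        fun v => ⟨ofReal_mem_openStrip hr v.1, hshift v.2 s habs⟩
    exact (hc.continuousOn.integrableOn_compact (isCompact_uIcc.prod isCompact_uIcc)).mono_set
      (Set.prod_mono Set.uIoc_subset_uIcc Set.uIoc_subset_uIcc)
  have hbound (x y : ℝ) :
      ‖G (x + (-s : ℝ) * I, y + s * I)‖ ≤ M * Real.exp (-s * (p + q)) := by
    have hmem : ((x + (-s : ℝ) * I, y + s * I) : ℂ × ℂ) ∈ closedStrip r ×ˢ closedStrip r :=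
      ⟨openStrip_subset_closedStrip r (hshift x (-s) (by rwa [abs_neg])),
        openStrip_subset_closedStrip r (hshift y s habs)⟩
    simp only [G]
    rw [norm_mul, norm_efunInv]
    have hexp : (p : ℝ) * ((x + (-s : ℝ) * I : ℂ)).im - q * ((y + s * I : ℂ)).im =
        -s * (p + q) := by
      simp
      ring
    rw [hexp]
    exact mul_le_mul_of_nonneg_right (hM _ hmem) (Real.exp_nonneg _)
  have hint : ‖∫ y in (0 : ℝ)..(2 * Real.pi), ∫ x in (0 : ℝ)..(2 * Real.pi),
      G (x + (-s : ℝ) * I, y + s * I)‖ ≤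
      M * Real.exp (-s * (p + q)) * |2 * Real.pi - 0| * |2 * Real.pi - 0| :=
    intervalIntegral.norm_integral_le_of_norm_le_const fun y _ =>
      intervalIntegral.norm_integral_le_of_norm_le_const fun x _ => hbound x y
  rw [fcoeff_eq_integral_efunInv]
  change ‖_ * ∫ x in (0 : ℝ)..(2 * Real.pi), ∫ y in (0 : ℝ)..(2 * Real.pi), G (x, y)‖ ≤ _
  simp_rw [hy]
  rw [hswap]
  simp_rw [hx]
  rw [norm_mul, Complex.norm_of_nonneg (by positivity)]
  refine (mul_le_mul_of_nonneg_left hint (by positivity)).trans (le_of_eq ?_)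
  rw [sub_zero, abs_of_pos Real.two_pi_pos]
  field_simp

/-- The fundamental square `(0, 2π]²` of the torus. -/
noncomputable def fundSquare : Set (ℝ × ℝ) :=
  Set.Ioc 0 (2 * Real.pi) ×ˢ Set.Ioc 0 (2 * Real.pi)

theorem volume_fundSquare_lt_top : MeasureTheory.volume fundSquare < ⊤ :=
  (Metric.isBounded_Ioc _ _ |>.prod (Metric.isBounded_Ioc _ _)).measure_lt_top

theorem integrableOn_fundSquare {f : ℝ × ℝ → ℂ} {C : ℝ} (hf : Measurable f)
    (hC : ∀ v, ‖f v‖ ≤ C) : MeasureTheory.IntegrableOn f fundSquare :=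
  MeasureTheory.Measure.integrableOn_of_bounded volume_fundSquare_lt_top.ne
    hf.aestronglyMeasurable (Filter.Eventually.of_forall hC)

theorem intervalIntegrable_of_bounded {f : ℝ → ℂ} {C : ℝ} (hf : Measurable f)
    (hC : ∀ x, ‖f x‖ ≤ C) (a b : ℝ) : IntervalIntegrable f MeasureTheory.volume a b := by
  rw [intervalIntegrable_iff]
  exact MeasureTheory.Measure.integrableOn_of_bounded (by simp)
    hf.aestronglyMeasurable (Filter.Eventually.of_forall hC)

theorem iterated_integral_eq_fundSquare {f : ℝ × ℝ → ℂ}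
    (hf : MeasureTheory.IntegrableOn f fundSquare) :
    ∫ x in (0 : ℝ)..(2 * Real.pi), ∫ y in (0 : ℝ)..(2 * Real.pi), f (x, y) =
      ∫ v in fundSquare, f v := by
  rw [fundSquare, MeasureTheory.Measure.volume_eq_prod, MeasureTheory.setIntegral_prod f hf,
    intervalIntegral.integral_of_le Real.two_pi_pos.le]
  simp_rw [intervalIntegral.integral_of_le Real.two_pi_pos.le]

theorem iterated_integral_swap {f : ℝ × ℝ → ℂ}
    (hf : MeasureTheory.IntegrableOn f fundSquare) :
    ∫ x in (0 : ℝ)..(2 * Real.pi), ∫ y in (0 : ℝ)..(2 * Real.pi), f (x, y) =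
      ∫ y in (0 : ℝ)..(2 * Real.pi), ∫ x in (0 : ℝ)..(2 * Real.pi), f (x, y) := by
  refine MeasureTheory.intervalIntegral_intervalIntegral_swap (F := fun x y : ℝ => f (x, y)) ?_
  rw [Set.uIoc_of_le Real.two_pi_pos.le]
  exact hf

theorem fcoeff_eq_fundSquare {b : ℂ × ℂ → ℂ} {p q : ℤ}
    (hb : MeasureTheory.IntegrableOn
      (fun v : ℝ × ℝ => b (v.1, v.2) * efunInv p q (v.1, v.2)) fundSquare) :
    fcoeff b p q = (1 / (2 * Real.pi) ^ 2 : ℝ) *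
      ∫ v in fundSquare, b ((v.1 : ℂ), (v.2 : ℂ)) * efunInv p q (v.1, v.2) := by
  rw [fcoeff_eq_integral_efunInv, ← iterated_integral_eq_fundSquare hb]

theorem integral_exp_int_mul (m : ℤ) :
    ∫ x in Set.Ioc (0 : ℝ) (2 * Real.pi), Complex.exp (Complex.I * (m * x)) =
      if m = 0 then (2 * Real.pi : ℂ) else 0 := by
  rw [← intervalIntegral.integral_of_le Real.two_pi_pos.le]
  split_ifs with hm
  · simp [hm]
  · have hc : Complex.I * m ≠ 0 := mul_ne_zero Complex.I_ne_zero (Int.cast_ne_zero.2 hm)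
    simp_rw [← mul_assoc]
    rw [integral_exp_mul_complex hc]
    have h1 : Complex.exp (Complex.I * m * ((2 * Real.pi : ℝ) : ℂ)) = 1 := by
      rw [Complex.exp_eq_one_iff]
      exact ⟨m, by push_cast; ring⟩
    rw [h1]
    simp

theorem setIntegral_efun (p q : ℤ) :
    ∫ v in fundSquare, efun p q ((v.1 : ℂ), (v.2 : ℂ)) =
      if p = 0 ∧ q = 0 then (2 * Real.pi : ℂ) ^ 2 else 0 := by
  have hsplit (v : ℝ × ℝ) : efun p q ((v.1 : ℂ), (v.2 : ℂ)) =
      Complex.exp (Complex.I * (p * v.1)) * Complex.exp (Complex.I * ((-q : ℤ) * v.2)) := by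
    rw [efun, ← Complex.exp_add]
    congr 1
    push_cast
    ring
  simp_rw [hsplit]
  rw [fundSquare, MeasureTheory.Measure.volume_eq_prod, MeasureTheory.setIntegral_prod_mul
    (fun x : ℝ => Complex.exp (Complex.I * (p * x)))
    (fun y : ℝ => Complex.exp (Complex.I * ((-q : ℤ) * y))),
    integral_exp_int_mul, integral_exp_int_mul]
  by_cases hp : p = 0 <;> by_cases hq : q = 0 <;> simp [hp, hq, sq]

theorem MemP0.continuous_ofReal {r : ℝ} {g : ℂ × ℂ → ℂ} (hg : MemP0 r g) (hr : 0 < r) :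
    Continuous fun v : ℝ × ℝ => g (v.1, v.2) :=
  hg.contOn.comp_continuous (by fun_prop) fun v =>
    ⟨openStrip_subset_closedStrip r (ofReal_mem_openStrip hr v.1),
      openStrip_subset_closedStrip r (ofReal_mem_openStrip hr v.2)⟩

theorem MemP0.hasFDerivAt_ofReal {r : ℝ} {g : ℂ × ℂ → ℂ} (hg : MemP0 r g) (hr : 0 < r)
    (x y : ℝ) : HasFDerivAt g (fderiv ℂ g (x, y)) (x, y) :=
  ((hg.diffOn _ ⟨ofReal_mem_openStrip hr x, ofReal_mem_openStrip hr y⟩).differentiableAt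
    (((isOpen_openStrip r).prod (isOpen_openStrip r)).mem_nhds
      ⟨ofReal_mem_openStrip hr x, ofReal_mem_openStrip hr y⟩)).hasFDerivAt

theorem MemP0.exists_norm_fderiv_le {r : ℝ} {g : ℂ × ℂ → ℂ} (hg : MemP0 r g) (hr : 0 < r) :
    ∃ M : ℝ, ∀ x y : ℝ, ‖fderiv ℂ g (x, y)‖ ≤ M := by
  obtain ⟨M, -, hM⟩ := hg.exists_bound
  refine ⟨2 * M / r, fun x y => ?_⟩
  have hball : Metric.ball ((x, y) : ℂ × ℂ) r ⊆ openStrip r ×ˢ openStrip r := by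
    rintro ⟨z, w⟩ hzw
    rw [Metric.mem_ball, Prod.dist_eq, max_lt_iff, Complex.dist_eq, Complex.dist_eq] at hzw
    refine ⟨(le_of_eq ?_).trans_lt ((Complex.abs_im_le_norm _).trans_lt hzw.1),
      (le_of_eq ?_).trans_lt ((Complex.abs_im_le_norm _).trans_lt hzw.2)⟩ <;> simp
  have hcl : Metric.ball ((x, y) : ℂ × ℂ) r ⊆ closedStrip r ×ˢ closedStrip r :=
    hball.trans (Set.prod_mono (openStrip_subset_closedStrip r) (openStrip_subset_closedStrip r))
  refine Complex.norm_fderiv_le_div_of_mapsTo_ball (hg.diffOn.mono hball) (fun z hz => ?_) hr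
  rw [Metric.mem_closedBall, dist_eq_norm]
  refine (norm_sub_le _ _).trans ?_
  have := hM z (hcl hz)
  have := hM (x, y) (hcl (Metric.mem_ball_self hr))
  linarith

theorem norm_efunInv_ofReal (p q : ℤ) (x y : ℝ) : ‖efunInv p q (x, y)‖ = 1 := by
  rw [norm_efunInv]
  simp

theorem hasDerivAt_efunInv_fst (p q : ℤ) (z w : ℂ) :
    HasDerivAt (fun z => efunInv p q (z, w)) (-(Complex.I * p) * efunInv p q (z, w)) z := by
  unfold efunInv
  have h := ((((hasDerivAt_id z).const_mul (p : ℂ)).sub_const (q * w)).const_mul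
    (-Complex.I)).cexp
  refine h.congr_deriv ?_
  simp only [id]
  ring

theorem hasDerivAt_efunInv_snd (p q : ℤ) (z w : ℂ) :
    HasDerivAt (fun w => efunInv p q (z, w)) (Complex.I * q * efunInv p q (z, w)) w := by
  unfold efunInv
  have h := ((((hasDerivAt_id w).const_mul (q : ℂ)).const_sub (p * z)).const_mul
    (-Complex.I)).cexp
  refine h.congr_deriv ?_
  simp only [id]
  ring

/-- Differentiation along the constant field `(1, ω)` acts on Fourier coefficients by
multiplication with `i(p - qω)`. -/
theorem MemP0.fcoeff_cohomOp {r : ℝ} {g : ℂ × ℂ → ℂ} (hg : MemP0 r g) (hr : 0 < r) (ω : ℝ)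
    (p q : ℤ) :
    fcoeff (cohomOp ω g) p q = Complex.I * ((p : ℂ) - (q : ℂ) * (ω : ℂ)) * fcoeff g p q := by
  obtain ⟨M, hM⟩ := hg.exists_norm_fderiv_le hr
  have hEc : Continuous fun v : ℝ × ℝ => efunInv p q (v.1, v.2) :=
    (differentiable_efunInv p q).continuous.comp (by fun_prop)
  have hgE : Continuous fun v : ℝ × ℝ => g (v.1, v.2) * efunInv p q (v.1, v.2) :=
    (hg.continuous_ofReal hr).mul hEc
  have hDm (u : ℂ × ℂ) : Measurable
      fun v : ℝ × ℝ => fderiv ℂ g (v.1, v.2) u * efunInv p q (v.1, v.2) :=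
    ((measurable_fderiv_apply_const ℂ g u).comp (by fun_prop)).mul hEc.measurable
  have hDb (u : ℂ × ℂ) (v : ℝ × ℝ) :
      ‖fderiv ℂ g (v.1, v.2) u * efunInv p q (v.1, v.2)‖ ≤ M * ‖u‖ := by
    rw [norm_mul, norm_efunInv_ofReal, mul_one]
    exact (fderiv ℂ g (v.1, v.2)).le_of_opNorm_le (hM v.1 v.2) u
  have hDi (u : ℂ × ℂ) := integrableOn_fundSquare (hDm u) (hDb u)
  have hgi : MeasureTheory.IntegrableOn
      (fun v : ℝ × ℝ => g (v.1, v.2) * efunInv p q (v.1, v.2)) fundSquare :=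
    (hgE.continuousOn.integrableOn_compact (isCompact_Icc.prod isCompact_Icc)).mono_set
      (Set.prod_mono Set.Ioc_subset_Icc_self Set.Ioc_subset_Icc_self)
  have hinner1 (y : ℝ) : ∫ x in (0 : ℝ)..(2 * Real.pi),
      fderiv ℂ g (x, y) (1, 0) * efunInv p q (x, y) =
      Complex.I * p * ∫ x in (0 : ℝ)..(2 * Real.pi), g (x, y) * efunInv p q (x, y) := by
    have hi1 : IntervalIntegrable (fun x : ℝ => fderiv ℂ g (x, y) (1, 0) * efunInv p q (x, y))
        MeasureTheory.volume 0 (2 * Real.pi) :=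
      intervalIntegrable_of_bounded ((hDm (1, 0)).comp measurable_prodMk_right)
        (fun x => hDb (1, 0) (x, y)) _ _
    have hi2 : IntervalIntegrable (fun x : ℝ => g (x, y) * efunInv p q (x, y))
        MeasureTheory.volume 0 (2 * Real.pi) :=
      (hgE.comp (by fun_prop : Continuous fun x : ℝ => (x, y))).intervalIntegrable _ _
    have hd (x : ℝ) : HasDerivAt (fun x : ℝ => g (x, y) * efunInv p q (x, y))
        (fderiv ℂ g (x, y) (1, 0) * efunInv p q (x, y) -
          Complex.I * p * (g (x, y) * efunInv p q (x, y))) x := by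
      have h1 : HasDerivAt (fun z : ℂ => g (z, y)) (fderiv ℂ g (x, y) (1, 0)) x :=
        HasFDerivAt.comp_hasDerivAt (x : ℂ) (hg.hasFDerivAt_ofReal hr x y)
          ((hasDerivAt_id (x : ℂ)).prodMk (hasDerivAt_const (x : ℂ) (y : ℂ)))
      refine (h1.mul (hasDerivAt_efunInv_fst p q x y)).comp_ofReal.congr_deriv ?_
      ring
    have hftc := intervalIntegral.integral_eq_sub_of_hasDerivAt (a := 0) (b := 2 * Real.pi)
      (fun x _ => hd x) (hi1.sub (hi2.const_mul _))
    rw [intervalIntegral.integral_sub hi1 (hi2.const_mul _),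
      intervalIntegral.integral_const_mul] at hftc
    have hper : g ((2 * Real.pi : ℝ), y) * efunInv p q ((2 * Real.pi : ℝ), y) =
        g ((0 : ℝ), y) * efunInv p q ((0 : ℝ), y) := by
      have e1 := hg.periodic_fst (0, y)
      have e2 := efunInv_periodic_fst p q (0, y)
      simp only [zero_add] at e1 e2
      push_cast
      rw [e1, e2]
    rw [hper, sub_self] at hftc
    exact sub_eq_zero.1 hftc
  have hinner2 (x : ℝ) : ∫ y in (0 : ℝ)..(2 * Real.pi),
      fderiv ℂ g (x, y) (0, 1) * efunInv p q (x, y) =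
      -(Complex.I * q) * ∫ y in (0 : ℝ)..(2 * Real.pi), g (x, y) * efunInv p q (x, y) := by
    have hi1 : IntervalIntegrable (fun y : ℝ => fderiv ℂ g (x, y) (0, 1) * efunInv p q (x, y))
        MeasureTheory.volume 0 (2 * Real.pi) :=
      intervalIntegrable_of_bounded ((hDm (0, 1)).comp measurable_prodMk_left)
        (fun y => hDb (0, 1) (x, y)) _ _
    have hi2 : IntervalIntegrable (fun y : ℝ => g (x, y) * efunInv p q (x, y))
        MeasureTheory.volume 0 (2 * Real.pi) :=
      (hgE.comp (by fun_prop : Continuous fun y : ℝ => (x, y))).intervalIntegrable _ _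
    have hd (y : ℝ) : HasDerivAt (fun y : ℝ => g (x, y) * efunInv p q (x, y))
        (fderiv ℂ g (x, y) (0, 1) * efunInv p q (x, y) -
          -(Complex.I * q) * (g (x, y) * efunInv p q (x, y))) y := by
      have h1 : HasDerivAt (fun w : ℂ => g (x, w)) (fderiv ℂ g (x, y) (0, 1)) y :=
        HasFDerivAt.comp_hasDerivAt (y : ℂ) (hg.hasFDerivAt_ofReal hr x y)
          ((hasDerivAt_const (y : ℂ) (x : ℂ)).prodMk (hasDerivAt_id (y : ℂ)))
      refine (h1.mul (hasDerivAt_efunInv_snd p q x y)).comp_ofReal.congr_deriv ?_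
      ring
    have hftc := intervalIntegral.integral_eq_sub_of_hasDerivAt (a := 0) (b := 2 * Real.pi)
      (fun y _ => hd y) (hi1.sub (hi2.const_mul _))
    rw [intervalIntegral.integral_sub hi1 (hi2.const_mul _),
      intervalIntegral.integral_const_mul] at hftc
    have hper : g (x, (2 * Real.pi : ℝ)) * efunInv p q (x, (2 * Real.pi : ℝ)) =
        g (x, (0 : ℝ)) * efunInv p q (x, (0 : ℝ)) := by
      have e1 := hg.periodic_snd (x, 0)
      have e2 := efunInv_periodic_snd p q (x, 0)
      simp only [zero_add] at e1 e2
      push_cast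
      rw [e1, e2]
    rw [hper, sub_self] at hftc
    exact sub_eq_zero.1 hftc
  have hA : ∫ v in fundSquare, fderiv ℂ g (v.1, v.2) (1, 0) * efunInv p q (v.1, v.2) =
      Complex.I * p * ∫ v in fundSquare, g (v.1, v.2) * efunInv p q (v.1, v.2) := by
    rw [← iterated_integral_eq_fundSquare (hDi (1, 0)), iterated_integral_swap (hDi (1, 0)),
      ← iterated_integral_eq_fundSquare hgi, iterated_integral_swap hgi]
    simp_rw [hinner1]
    rw [intervalIntegral.integral_const_mul]
  have hB : ∫ v in fundSquare, fderiv ℂ g (v.1, v.2) (0, 1) * efunInv p q (v.1, v.2) =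
      -(Complex.I * q) * ∫ v in fundSquare, g (v.1, v.2) * efunInv p q (v.1, v.2) := by
    rw [← iterated_integral_eq_fundSquare (hDi (0, 1)), ← iterated_integral_eq_fundSquare hgi]
    simp_rw [hinner2]
    rw [intervalIntegral.integral_const_mul]
  have hsplit : (fun v : ℝ × ℝ => cohomOp ω g (v.1, v.2) * efunInv p q (v.1, v.2)) =
      fun v : ℝ × ℝ => fderiv ℂ g (v.1, v.2) (1, 0) * efunInv p q (v.1, v.2) +
        ω * (fderiv ℂ g (v.1, v.2) (0, 1) * efunInv p q (v.1, v.2)) := by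
    funext v
    rw [cohomOp]
    ring
  have hci : MeasureTheory.IntegrableOn
      (fun v : ℝ × ℝ => cohomOp ω g (v.1, v.2) * efunInv p q (v.1, v.2)) fundSquare := by
    rw [hsplit]
    exact (hDi (1, 0)).add ((hDi (0, 1)).const_mul _)
  rw [fcoeff_eq_fundSquare hci, fcoeff_eq_fundSquare hgi, hsplit,
    MeasureTheory.integral_add (hDi (1, 0)) ((hDi (0, 1)).const_mul _),
    MeasureTheory.integral_const_mul, hA, hB]
  ring

theorem fcoeff_ahatFun_convergent {ω : ℝ} (h : Irrational ω) (h0 : 0 < ω) (h1 : ω < 1)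
    {ρ ε : ℝ} (hρ : 0 < ρ) (hε : 0 < ε) (n : ℕ) :
    fcoeff (ahatFun ω ρ ε) (cfP ω (n + 1)) (cfQ ω (n + 1)) =
      (ahatCoeff ω ρ ε (cfP ω (n + 1)) (cfQ ω (n + 1)) : ℝ) := by
  set P : ℤ := (cfP ω (n + 1) : ℤ) with hP
  set Q : ℤ := (cfQ ω (n + 1) : ℤ) with hQ
  let c : ℕ → ℝ := fun k => ε * alphaN ω (k + 1) *
    Real.exp (-ρ * ((cfP ω (k + 1) : ℝ) + (cfQ ω (k + 1) : ℝ)))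
  have hc0 (k : ℕ) : 0 ≤ c k := by
    have := alphaN_pos h h0 h1 (k + 1)
    positivity
  have hcs : Summable c := by
    refine Summable.of_nonneg_of_le hc0 (fun k => ?_) ((summable_alphaN h h0 h1).mul_left ε)
    refine mul_le_of_le_one_right (mul_nonneg hε.le (alphaN_pos h h0 h1 _).le) ?_
    rw [Real.exp_le_one_iff, neg_mul, neg_nonpos]
    positivity
  let F : ℕ → ℝ × ℝ → ℂ := fun k v => (c k : ℂ) *
    (efun (cfP ω (k + 1) : ℤ) (cfQ ω (k + 1) : ℤ) (v.1, v.2) +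
      efun (-(cfP ω (k + 1) : ℤ)) (-(cfQ ω (k + 1) : ℤ)) (v.1, v.2)) * efunInv P Q (v.1, v.2)
  have hFc (k : ℕ) : Continuous (F k) := by
    refine Continuous.mul (continuous_const.mul (Continuous.add ?_ ?_)) ?_
    · exact (continuous_efun _ _).comp (by fun_prop)
    · exact (continuous_efun _ _).comp (by fun_prop)
    · exact (differentiable_efunInv P Q).continuous.comp (by fun_prop)
  have hFb (k : ℕ) (v : ℝ × ℝ) : ‖F k v‖ ≤ c k * 2 := by
    simp only [F]
    rw [norm_mul, norm_efunInv_ofReal, mul_one, norm_mul, Complex.norm_of_nonneg (hc0 k)]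
    refine mul_le_mul_of_nonneg_left ((norm_add_le _ _).trans (le_of_eq ?_)) (hc0 k)
    rw [norm_efun_ofReal, norm_efun_ofReal]
    norm_num
  have hFi (k : ℕ) : MeasureTheory.IntegrableOn (F k) fundSquare :=
    integrableOn_fundSquare (hFc k).measurable (hFb k)
  have htsum (v : ℝ × ℝ) :
      ahatFun ω ρ ε (v.1, v.2) * efunInv P Q (v.1, v.2) = ∑' k, F k v := by
    rw [ahatFun, ← tsum_mul_right]
  have hTi : MeasureTheory.IntegrableOn
      (fun v : ℝ × ℝ => ahatFun ω ρ ε (v.1, v.2) * efunInv P Q (v.1, v.2)) fundSquare := by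
    simp_rw [htsum]
    exact integrableOn_fundSquare (continuous_tsum hFc (hcs.mul_right 2) hFb).measurable
      fun v => tsum_of_norm_bounded (hcs.mul_right 2).hasSum fun k => hFb k v
  have hsum : HasSum (fun k => ∫ v in fundSquare, F k v) (∫ v in fundSquare, ∑' k, F k v) := by
    refine MeasureTheory.hasSum_integral_of_summable_integral_norm hFi ?_
    refine Summable.of_nonneg_of_le (fun k => by positivity) (fun k => ?_)
      ((hcs.mul_right 2).mul_right (MeasureTheory.volume.real fundSquare))
    have := MeasureTheory.norm_setIntegral_le_of_norm_le_const (f := fun v => ‖F k v‖)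
      volume_fundSquare_lt_top fun v _ => (norm_norm (F k v)).trans_le (hFb k v)
    exact (le_abs_self _).trans this
  have hone (k : ℕ) : ∫ v in fundSquare, F k v =
      if k = n then (c k : ℂ) * (2 * Real.pi) ^ 2 else 0 := by
    have hcont (p q : ℤ) : MeasureTheory.IntegrableOn
        (fun v : ℝ × ℝ => efun p q (v.1, v.2)) fundSquare :=
      integrableOn_fundSquare (((continuous_efun p q).comp (by fun_prop)).measurable)
        fun v => (norm_efun_ofReal p q v.1 v.2).le
    simp only [F, mul_assoc, add_mul, efun_mul_efunInv]
    rw [MeasureTheory.integral_const_mul, MeasureTheory.integral_add (hcont _ _) (hcont _ _),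
      setIntegral_efun, setIntegral_efun]
    have hq := cfQ_pos h h0 h1 (k + 1)
    have hq' := cfQ_pos h h0 h1 (n + 1)
    rw [if_neg (fun hh : -(cfP ω (k + 1) : ℤ) - P = 0 ∧ -(cfQ ω (k + 1) : ℤ) - Q = 0 => by omega),
      add_zero]
    by_cases hkn : k = n
    · subst hkn
      simp [hP, hQ]
    · rw [if_neg, if_neg hkn, mul_zero]
      rintro ⟨-, h2⟩
      exact hkn ((cfQ_succ_strictMono h h0 h1).injective
        (Int.ofNat_injective (sub_eq_zero.1 h2)))
  have hval := (hasSum_ite_eq n ((c n : ℂ) * (2 * Real.pi) ^ 2)).unique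
    (hsum.congr_fun fun k => by rw [hone]; split_ifs with hk <;> simp [hk])
  rw [fcoeff_eq_fundSquare hTi]
  simp_rw [htsum]
  rw [← hval, ahatCoeff_convergent h h0 h1]
  have hpi : (Real.pi : ℂ) ≠ 0 := Complex.ofReal_ne_zero.2 Real.pi_ne_zero
  push_cast [c]
  field_simp

theorem MemP0.false_of_fcoeff_convergent {ρ ε ω δ δ' : ℝ} (hε : 0 < ε)
    (h : Irrational ω) (h0 : 0 < ω) (h1 : ω < 1)
    (hδ'0 : 0 < δ') (hδ'δ : δ' < δ) (hδρ : δ < ρ)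
    (hdiv :
      (∑' n : ℕ, ENNReal.ofReal
          (Real.exp (-(cfQ ω (n + 1) : ℝ) * ((1 + ω) * δ)) * (cfQ ω (n + 2) : ℝ))) = ⊤ ∨
      (∑' n : ℕ, ENNReal.ofReal
          (Real.exp (-2 * (cfQ ω (n + 1) : ℝ) * ((1 + ω) * δ)) * (cfQ ω (n + 2) : ℝ) *
            Real.log (cfA ω (n + 2) : ℝ))) = ⊤)
    {g : ℂ × ℂ → ℂ} (hg : MemP0 (ρ - δ') g)
    (hcoeff : ∀ n : ℕ,
      Complex.I * (((cfP ω (n + 1) : ℤ) : ℂ) - ((cfQ ω (n + 1) : ℤ) : ℂ) * (ω : ℂ)) *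
        fcoeff g (cfP ω (n + 1)) (cfQ ω (n + 1)) =
          ((ahatCoeff ω ρ ε (cfP ω (n + 1)) (cfQ ω (n + 1)) : ℝ) : ℂ)) : False := by
  obtain ⟨τ, hδ'τ, hτδ⟩ := exists_between hδ'δ
  obtain ⟨M, hM0, hM⟩ := hg.exists_norm_fcoeff_le (s := ρ - τ) (by linarith) (by linarith)
  have hκ : (1 + ω) * τ < (1 + ω) * δ := mul_lt_mul_of_pos_left hτδ (by linarith)
  have hα := alphaBar_pos h h0 h1
  have hgrow (n : ℕ) : (cfQ ω (n + 2) : ℝ) ≤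
      (M / ε * (2 * alphaBar ω) * Real.exp τ) * cfQ ω (n + 1) *
        Real.exp ((1 + ω) * τ * cfQ ω (n + 1)) := by
    have hqpos : (0 : ℝ) < cfQ ω (n + 1) := Nat.cast_pos.2 (cfQ_pos h h0 h1 _)
    have herr := cfQ_succ_mul_abs_error_le_one h h0 h1 (n + 1)
    have hp := cfP_le h h0 h1 (n + 1)
    have hM' := hM (cfP ω (n + 1)) (cfQ ω (n + 1))
    have hnorm := congrArg norm (hcoeff n)
    rw [ahatCoeff_convergent h h0 h1, norm_mul, norm_mul, Complex.norm_I, one_mul,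
      Complex.norm_of_nonneg (by have := alphaN_pos h h0 h1 (n + 1); positivity)] at hnorm
    have hcast : (((cfP ω (n + 1) : ℤ) : ℂ) - ((cfQ ω (n + 1) : ℤ) : ℂ) * (ω : ℂ)) =
        (((cfP ω (n + 1) : ℝ) - cfQ ω (n + 1) * ω : ℝ) : ℂ) := by
      push_cast
      rfl
    rw [hcast, Complex.norm_real, Real.norm_eq_abs] at hnorm
    simp only [Int.cast_natCast] at hM'
    set S : ℝ := (cfP ω (n + 1) : ℝ) + cfQ ω (n + 1) with hS
    set D : ℝ := |(cfP ω (n + 1) : ℝ) - cfQ ω (n + 1) * ω|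
    have hscaled : (cfQ ω (n + 2) : ℝ) * (ε * alphaN ω (n + 1)) * Real.exp (-ρ * S) ≤
        M * Real.exp (τ * S) * Real.exp (-ρ * S) := by
      calc (cfQ ω (n + 2) : ℝ) * (ε * alphaN ω (n + 1)) * Real.exp (-ρ * S)
          = cfQ ω (n + 2) * D * ‖fcoeff g (cfP ω (n + 1)) (cfQ ω (n + 1))‖ := by
            rw [mul_assoc, ← hnorm, mul_assoc]
        _ ≤ 1 * (M * Real.exp (-(ρ - τ) * S)) :=
            mul_le_mul herr hM' (norm_nonneg _) zero_le_one
        _ = M * Real.exp (τ * S) * Real.exp (-ρ * S) := by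
            rw [one_mul, mul_assoc, ← Real.exp_add]
            ring_nf
    have hbase := le_of_mul_le_mul_right hscaled (Real.exp_pos _)
    have hexp : Real.exp (τ * S) ≤ Real.exp τ * Real.exp ((1 + ω) * τ * cfQ ω (n + 1)) := by
      rw [← Real.exp_add, Real.exp_le_exp]
      have : τ * S ≤ τ * (cfQ ω (n + 1) * ω + 1 + cfQ ω (n + 1)) :=
        mul_le_mul_of_nonneg_left (by linarith) (hδ'0.trans hδ'τ).le
      linarith
    have hfinal := hbase.trans (mul_le_mul_of_nonneg_left hexp hM0)
    rw [alphaN, ← div_eq_mul_inv, mul_div_assoc', div_le_iff₀ (by positivity)] at hfinal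
    calc (cfQ ω (n + 2) : ℝ) = cfQ ω (n + 2) * ε / ε := by field_simp
      _ ≤ M * (Real.exp τ * Real.exp ((1 + ω) * τ * cfQ ω (n + 1))) *
          (2 * alphaBar ω * cfQ ω (n + 1)) / ε := by gcongr
      _ = _ := by ring
  obtain ⟨t1, t2⟩ := brjuno_sums_ne_top h h0 h1 hκ hgrow
  exact hdiv.elim t1 t2

/-- if `𝔅rj₁(Δ) = ∞` or `𝔅rj₂(2Δ) = ∞` with `Δ = (1+ω)δ`, then no
`g ∈ 𝒫₀(ρ-δ')` has Fourier coefficients solving `i(p-qω) g_{p,q} = â_{p,q}` for all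
`(p,q) ≠ (0,0)`; in particular no `g ∈ 𝒫₀(ρ-δ')` satisfies `(∂_x + ω∂_y) g = â` on the
open bi-strip of radius `ρ-δ'`. -/
theorem no_analytic_solution (ρ ε ω δ δ' : ℝ) (hρ : 0 < ρ) (hε : 0 < ε)
    (hirr : Irrational ω) (hω0 : 0 < ω) (hω1 : ω < 1)
    (hδ'0 : 0 < δ') (hδ'δ : δ' < δ) (hδρ : δ < ρ)
    (hdiv :
      (∑' n : ℕ, ENNReal.ofReal
          (Real.exp (-(cfQ ω (n + 1) : ℝ) * ((1 + ω) * δ)) * (cfQ ω (n + 2) : ℝ))) = ⊤ ∨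
      (∑' n : ℕ, ENNReal.ofReal
          (Real.exp (-2 * (cfQ ω (n + 1) : ℝ) * ((1 + ω) * δ)) * (cfQ ω (n + 2) : ℝ) *
            Real.log (cfA ω (n + 2) : ℝ))) = ⊤) :
    (¬ ∃ g : ℂ × ℂ → ℂ, MemP0 (ρ - δ') g ∧
        ∀ p q : ℤ, (p, q) ≠ (0, 0) →
          Complex.I * ((p : ℂ) - (q : ℂ) * (ω : ℂ)) * fcoeff g p q =
            ((ahatCoeff ω ρ ε p q : ℝ) : ℂ)) ∧
    (¬ ∃ g : ℂ × ℂ → ℂ, MemP0 (ρ - δ') g ∧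
        ∀ z ∈ openStrip (ρ - δ') ×ˢ openStrip (ρ - δ'), cohomOp ω g z = ahatFun ω ρ ε z) := by
  constructor
  · rintro ⟨g, hg, hcoeff⟩
    refine hg.false_of_fcoeff_convergent hε hirr hω0 hω1 hδ'0 hδ'δ hδρ hdiv fun n => ?_
    refine hcoeff _ _ fun hpq => ?_
    have hq := cfQ_pos hirr hω0 hω1 (n + 1)
    have := congrArg Prod.snd hpq
    simp only at this
    omega
  · rintro ⟨g, hg, hcohom⟩
    have hr : 0 < ρ - δ' := by linarith
    refine hg.false_of_fcoeff_convergent hε hirr hω0 hω1 hδ'0 hδ'δ hδρ hdiv fun n => ?_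
    rw [← hg.fcoeff_cohomOp hr, ← fcoeff_ahatFun_convergent hirr hω0 hω1 hρ hε]
    simp only [fcoeff]
    simp_rw [fun x y : ℝ => hcohom (x, y) ⟨ofReal_mem_openStrip hr x, ofReal_mem_openStrip hr y⟩]
end
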